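/- Let λ ∈ ℝ \ {a, b, −c} and let γ(t) = r₊(λ, t) be the parametrization of a tropic curve of Q_λ. Then for all t: ⟨γ'(t), γ'(t)⟩ = (a + b − 2λ − (a−b)·cos 2t)² / (2(a + b + 2c − (a−b)·cos 2t)) ≥ 0 (the denominator is positive), so γ'(t) is never time-like; γ'(t) is light-like exactly when 2λ = a + b − (a−b)·cos 2t, which is possible only for λ ∈ [b, a], and for λ ∈ (b, a) there are exactly four values t ∈ [0, 2π) with this property. Moreover, the whole tangent line {γ(t) + τ·γ'(t) : τ ∈ ℝ} is contained in Q_λ if and only if γ'(t) is light-like. The same statements hold for r₋. -/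

import Mathlib

/-- For `0 < u < π / 2`, the equation `cos (2 * t) = cos (2 * u)` has exactly four solutions
in `[0, 2π)`. -/
theorem ncard_cos_two_mul_eq {u : ℝ} (hu0 : 0 < u) (hu1 : u < Real.pi / 2) :
    ({t : ℝ | t ∈ Set.Ico 0 (2 * Real.pi) ∧ Real.cos (2 * t) = Real.cos (2 * u)}).ncard = 4 := by
  have hset : {t : ℝ | t ∈ Set.Ico 0 (2 * Real.pi) ∧ Real.cos (2 * t) = Real.cos (2 * u)} =
      {u, Real.pi - u, Real.pi + u, 2 * Real.pi - u} := by
    ext t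
    simp only [Set.mem_ofPred_eq, Set.mem_Ico, Set.mem_insert_iff, Set.mem_singleton_iff]
    constructor
    · rintro ⟨⟨ht0, ht1⟩, h⟩
      obtain ⟨k, hk | hk⟩ := Real.cos_eq_cos_iff.1 h.symm
      · have hk0 : (-1 : ℤ) < k := by
          by_contra! hle
          have : (k : ℝ) ≤ -1 := by exact_mod_cast hle
          nlinarith
        have hk1 : k < 2 := by
          by_contra! hle
          have : (2 : ℝ) ≤ k := by exact_mod_cast hle
          nlinarith
        interval_cases k
        · left; push_cast at hk; linarith
        · right; right; left; push_cast at hk; linarith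
      · have hk0 : (0 : ℤ) < k := by
          by_contra! hle
          have : (k : ℝ) ≤ 0 := by exact_mod_cast hle
          nlinarith
        have hk1 : k < 3 := by
          by_contra! hle
          have : (3 : ℝ) ≤ k := by exact_mod_cast hle
          nlinarith
        interval_cases k
        · right; left; push_cast at hk; linarith
        · right; right; right; push_cast at hk; linarith
    · rintro (rfl | rfl | rfl | rfl)
      · exact ⟨⟨by linarith, by linarith⟩, rfl⟩
      · refine ⟨⟨by linarith, by linarith⟩, Real.cos_eq_cos_iff.2 ⟨1, Or.inr ?_⟩⟩
        push_cast; ring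
      · refine ⟨⟨by linarith, by linarith⟩, Real.cos_eq_cos_iff.2 ⟨-1, Or.inl ?_⟩⟩
        push_cast; ring
      · refine ⟨⟨by linarith, by linarith⟩, Real.cos_eq_cos_iff.2 ⟨2, Or.inr ?_⟩⟩
        push_cast; ring
  have hfin : ({u, Real.pi - u, Real.pi + u, 2 * Real.pi - u} : Set ℝ) =
      (({u, Real.pi - u, Real.pi + u, 2 * Real.pi - u} : Finset ℝ) : Set ℝ) := by
    push_cast; rfl
  rw [hset, hfin, Set.ncard_coe_finset]
  have h12 : u ≠ Real.pi - u := by intro h; linarith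
  have h13 : u ≠ Real.pi + u := by intro h; linarith
  have h14 : u ≠ 2 * Real.pi - u := by intro h; linarith
  have h23 : Real.pi - u ≠ Real.pi + u := by intro h; linarith
  have h24 : Real.pi - u ≠ 2 * Real.pi - u := by intro h; linarith
  have h34 : Real.pi + u ≠ 2 * Real.pi - u := by intro h; linarith
  rw [Finset.card_insert_of_notMem (by simp only [Finset.mem_insert, Finset.mem_singleton]; tauto),
    Finset.card_insert_of_notMem (by simp only [Finset.mem_insert, Finset.mem_singleton]; tauto),
    Finset.card_insert_of_notMem (by simpa only [Finset.mem_singleton] using h34),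
    Finset.card_singleton]

/-- The norm identity for tangent vectors of a tropic curve, with `p = sin² t`, `q = cos² t`. -/
theorem sub_sq_mul_div_add_sub_eq {A B D m p q : ℝ} (hA : A ≠ 0) (hB : B ≠ 0) (hD : D ≠ 0)
    (hpq : p + q = 1) (hDpq : D = A * p + B * q) :
    (A - m) ^ 2 * p / A + (B - m) ^ 2 * q / B - m ^ 2 * (p * q) * (A - B) ^ 2 / (A * B * D) =
      (D - m) ^ 2 / D := by
  obtain rfl : q = 1 - p := by linarith
  field_simp
  rw [hDpq]
  ring

/-- The quadric form on tangent vectors of a tropic curve, with `p = sin² t`, `q = cos² t`. -/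
theorem sub_mul_div_add_add_eq {A B D m p q : ℝ} (hA : A ≠ 0) (hB : B ≠ 0) (hD : D ≠ 0)
    (hpq : p + q = 1) (hDpq : D = A * p + B * q) :
    (A - m) * p / A + (B - m) * q / B + m * (p * q) * (A - B) ^ 2 / (A * B * D) =
      (D - m) / D := by
  obtain rfl : q = 1 - p := by linarith
  field_simp
  rw [hDpq]
  ring

theorem hasDerivAt_sqrt_cos_sq_div_add_sin_sq_div {A B : ℝ} {t : ℝ}
    (hG : Real.cos t ^ 2 / A + Real.sin t ^ 2 / B ≠ 0) :
    HasDerivAt (fun s => Real.sqrt (Real.cos s ^ 2 / A + Real.sin s ^ 2 / B))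
      (Real.sin t * Real.cos t * (1 / B - 1 / A) /
        Real.sqrt (Real.cos t ^ 2 / A + Real.sin t ^ 2 / B)) t := by
  have h := ((((Real.hasDerivAt_cos t).pow 2).div_const A).add
    (((Real.hasDerivAt_sin t).pow 2).div_const B)).sqrt hG
  refine h.congr_deriv ?_
  simp only [Pi.add_apply, Pi.pow_apply, Nat.cast_ofNat, Nat.add_one_sub_one, pow_one]
  rw [mul_comm (2 : ℝ) (Real.sqrt _), ← div_div, div_right_comm]
  congr 1
  ring

open Real in
/- STATEMENT 16: for the tropic curve γ(t) = r±(λ,t) of Q_λ one has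
⟨γ',γ'⟩ = (a+b−2λ−(a−b)cos 2t)²/(2(a+b+2c−(a−b)cos 2t)) ≥ 0 with positive denominator
(so γ' is never time-like); γ' is light-like iff 2λ = a+b−(a−b)cos 2t, which forces
λ ∈ [b,a], and for λ ∈ (b,a) happens for exactly four t ∈ [0,2π); and the tangent line
of γ at t lies entirely in Q_λ iff γ'(t) is light-like. `sgn` covers r₊ and r₋. -/
theorem stmt16 (a b c lam : ℝ) (hab : b < a) (hb : 0 < b) (hc : 0 < c)
    (h1 : lam ≠ a) (h2 : lam ≠ b) (h3 : lam ≠ -c)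
    (g : ℝ → ℝ)
    (hg : ∀ t, g t = Real.sqrt (Real.cos t ^ 2 / (a + c) + Real.sin t ^ 2 / (b + c)))
    (sgn : ℝ) (hsgn : sgn = 1 ∨ sgn = -1)
    (γ : ℝ → ℝ × ℝ × ℝ)
    (hγ : ∀ t, γ t =
      ((a - lam) * Real.cos t / Real.sqrt (a + c),
       (b - lam) * Real.sin t / Real.sqrt (b + c),
       sgn * ((c + lam) * g t)))
    (γ' : ℝ → ℝ × ℝ × ℝ)
    (hγ' : ∀ t, γ' t =
      (deriv (fun s => (γ s).1) t, deriv (fun s => (γ s).2.1) t,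
        deriv (fun s => (γ s).2.2) t)) :
    (∀ t : ℝ,
      0 < 2 * (a + b + 2 * c - (a - b) * Real.cos (2 * t)) ∧
      (γ' t).1 ^ 2 + (γ' t).2.1 ^ 2 - (γ' t).2.2 ^ 2
        = (a + b - 2 * lam - (a - b) * Real.cos (2 * t)) ^ 2 /
            (2 * (a + b + 2 * c - (a - b) * Real.cos (2 * t))) ∧
      0 ≤ (γ' t).1 ^ 2 + (γ' t).2.1 ^ 2 - (γ' t).2.2 ^ 2) ∧
    (∀ t : ℝ,
      ((γ' t).1 ^ 2 + (γ' t).2.1 ^ 2 - (γ' t).2.2 ^ 2 = 0 ↔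
        2 * lam = a + b - (a - b) * Real.cos (2 * t))) ∧
    ((∃ t : ℝ, 2 * lam = a + b - (a - b) * Real.cos (2 * t)) → lam ∈ Set.Icc b a) ∧
    (lam ∈ Set.Ioo b a →
      ({t : ℝ | t ∈ Set.Ico 0 (2 * Real.pi) ∧
          2 * lam = a + b - (a - b) * Real.cos (2 * t)}).ncard = 4) ∧
    (∀ t : ℝ,
      ((∀ τ : ℝ,
          ((γ t).1 + τ * (γ' t).1) ^ 2 / (a - lam) +
            ((γ t).2.1 + τ * (γ' t).2.1) ^ 2 / (b - lam) +
            ((γ t).2.2 + τ * (γ' t).2.2) ^ 2 / (c + lam) = 1) ↔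
        (γ' t).1 ^ 2 + (γ' t).2.1 ^ 2 - (γ' t).2.2 ^ 2 = 0)) := by
  have hA : 0 < a + c := by linarith
  have hB : 0 < b + c := by linarith
  have hal : a - lam ≠ 0 := sub_ne_zero.2 h1.symm
  have hbl : b - lam ≠ 0 := sub_ne_zero.2 h2.symm
  have hcl : c + lam ≠ 0 := fun h => h3 (by linarith)
  have hs2 : sgn ^ 2 = 1 := by rcases hsgn with rfl | rfl <;> norm_num
  have hDpos (t : ℝ) : 0 < (a + c) * Real.sin t ^ 2 + (b + c) * Real.cos t ^ 2 := by
    nlinarith [Real.sin_sq_add_cos_sq t, sq_nonneg (Real.sin t)]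
  have hG (t : ℝ) : Real.cos t ^ 2 / (a + c) + Real.sin t ^ 2 / (b + c) =
      ((a + c) * Real.sin t ^ 2 + (b + c) * Real.cos t ^ 2) / ((a + c) * (b + c)) := by
    field_simp
    ring
  have hGpos (t : ℝ) : 0 < Real.cos t ^ 2 / (a + c) + Real.sin t ^ 2 / (b + c) := by
    rw [hG]
    exact div_pos (hDpos t) (mul_pos hA hB)
  have hgpos (t : ℝ) : 0 < g t := by
    rw [hg]
    exact Real.sqrt_pos.2 (hGpos t)
  have hg2 (t : ℝ) : g t ^ 2 =
      ((a + c) * Real.sin t ^ 2 + (b + c) * Real.cos t ^ 2) / ((a + c) * (b + c)) := by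
    rw [hg, Real.sq_sqrt (hGpos t).le, hG]
  have hden (t : ℝ) : a + b + 2 * c - (a - b) * Real.cos (2 * t) =
      2 * ((a + c) * Real.sin t ^ 2 + (b + c) * Real.cos t ^ 2) := by
    rw [Real.cos_two_mul, Real.sin_sq]
    ring
  have hx (t : ℝ) : (γ' t).1 = -((a - lam) * Real.sin t) / Real.sqrt (a + c) := by
    simp only [hγ', hγ]
    refine (((Real.hasDerivAt_cos t).const_mul _).div_const _).deriv.trans ?_
    ring
  have hy (t : ℝ) : (γ' t).2.1 = (b - lam) * Real.cos t / Real.sqrt (b + c) := by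
    simp only [hγ', hγ]
    exact (((Real.hasDerivAt_sin t).const_mul _).div_const _).deriv
  have hz (t : ℝ) : (γ' t).2.2 =
      sgn * ((c + lam) * (Real.sin t * Real.cos t * (1 / (b + c) - 1 / (a + c)) / g t)) := by
    simp only [hγ', hγ, hg]
    exact (((hasDerivAt_sqrt_cos_sq_div_add_sin_sq_div (hGpos t).ne').const_mul _).const_mul
      _).deriv
  have hx2 (t : ℝ) : (γ' t).1 ^ 2 = (a - lam) ^ 2 * Real.sin t ^ 2 / (a + c) := by
    rw [hx, div_pow, Real.sq_sqrt hA.le]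
    ring
  have hy2 (t : ℝ) : (γ' t).2.1 ^ 2 = (b - lam) ^ 2 * Real.cos t ^ 2 / (b + c) := by
    rw [hy, div_pow, Real.sq_sqrt hB.le]
    ring
  have hz2 (t : ℝ) : (γ' t).2.2 ^ 2 = (c + lam) ^ 2 * (Real.sin t ^ 2 * Real.cos t ^ 2) *
      (a - b) ^ 2 / ((a + c) * (b + c) *
        ((a + c) * Real.sin t ^ 2 + (b + c) * Real.cos t ^ 2)) := by
    have hD := (hDpos t).ne'
    rw [hz, mul_pow, hs2, mul_pow, div_pow, hg2]
    field_simp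
    ring
  have hnorm (t : ℝ) : (γ' t).1 ^ 2 + (γ' t).2.1 ^ 2 - (γ' t).2.2 ^ 2 =
      (a * Real.sin t ^ 2 + b * Real.cos t ^ 2 - lam) ^ 2 /
        ((a + c) * Real.sin t ^ 2 + (b + c) * Real.cos t ^ 2) := by
    have h := sub_sq_mul_div_add_sub_eq (m := c + lam) hA.ne' hB.ne' (hDpos t).ne'
      (Real.sin_sq_add_cos_sq t) rfl
    rw [hx2, hy2, hz2]
    convert h using 2
    · ring
    · ring
    · congr 1
      linear_combination -c * Real.sin_sq_add_cos_sq t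
  have hnum (t : ℝ) : a + b - 2 * lam - (a - b) * Real.cos (2 * t) =
      2 * (a * Real.sin t ^ 2 + b * Real.cos t ^ 2 - lam) := by
    rw [Real.cos_two_mul, Real.sin_sq]
    ring
  have hzero (t : ℝ) : (γ' t).1 ^ 2 + (γ' t).2.1 ^ 2 - (γ' t).2.2 ^ 2 = 0 ↔
      a * Real.sin t ^ 2 + b * Real.cos t ^ 2 - lam = 0 := by
    rw [hnorm, div_eq_zero_iff, or_iff_left (hDpos t).ne', sq_eq_zero_iff]
  have hline (t τ : ℝ) : ((γ t).1 + τ * (γ' t).1) ^ 2 / (a - lam) +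
      ((γ t).2.1 + τ * (γ' t).2.1) ^ 2 / (b - lam) +
      ((γ t).2.2 + τ * (γ' t).2.2) ^ 2 / (c + lam) =
      1 + τ ^ 2 * ((a * Real.sin t ^ 2 + b * Real.cos t ^ 2 - lam) /
        ((a + c) * Real.sin t ^ 2 + (b + c) * Real.cos t ^ 2)) := by
    have hg0 := (hgpos t).ne'
    have hX : ((γ t).1 + τ * (γ' t).1) ^ 2 =
        (a - lam) ^ 2 * (Real.cos t - τ * Real.sin t) ^ 2 / (a + c) := by
      rw [hx, hγ]
      dsimp only
      rw [← Real.sq_sqrt hA.le, Real.sqrt_sq (Real.sqrt_nonneg _)]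
      ring
    have hY : ((γ t).2.1 + τ * (γ' t).2.1) ^ 2 =
        (b - lam) ^ 2 * (Real.sin t + τ * Real.cos t) ^ 2 / (b + c) := by
      rw [hy, hγ]
      dsimp only
      rw [← Real.sq_sqrt hB.le, Real.sqrt_sq (Real.sqrt_nonneg _)]
      ring
    have hZ : ((γ t).2.2 + τ * (γ' t).2.2) ^ 2 = (c + lam) ^ 2 *
        (((a + c) * Real.sin t ^ 2 + (b + c) * Real.cos t ^ 2) / ((a + c) * (b + c)) +
        2 * τ * (Real.sin t * Real.cos t * (1 / (b + c) - 1 / (a + c)))) +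
        τ ^ 2 * (γ' t).2.2 ^ 2 := by
      have hcross : (γ t).2.2 * (γ' t).2.2 = (c + lam) ^ 2 *
          (Real.sin t * Real.cos t * (1 / (b + c) - 1 / (a + c))) := by
        rw [hz, hγ]
        dsimp only
        rw [← one_mul ((c + lam) ^ 2), ← hs2]
        field_simp
      have hsq : (γ t).2.2 ^ 2 = (c + lam) ^ 2 *
          (((a + c) * Real.sin t ^ 2 + (b + c) * Real.cos t ^ 2) / ((a + c) * (b + c))) := by
        rw [hγ, ← hg2]
        dsimp only
        rw [mul_pow, hs2]
        ring
      linear_combination hsq + 2 * τ * hcross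
    have hquad := sub_mul_div_add_add_eq (m := c + lam) hA.ne' hB.ne' (hDpos t).ne'
      (Real.sin_sq_add_cos_sq t) rfl
    have hcross : -(a - lam) / (a + c) + (b - lam) / (b + c) +
        (c + lam) * (1 / (b + c) - 1 / (a + c)) = 0 := by
      field_simp
      ring
    have hpoint : (a - lam) * Real.cos t ^ 2 / (a + c) + (b - lam) * Real.sin t ^ 2 / (b + c) +
        (c + lam) * (((a + c) * Real.sin t ^ 2 + (b + c) * Real.cos t ^ 2) /
          ((a + c) * (b + c))) = 1 := by
      rw [Real.cos_sq']
      field_simp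
      ring
    have hXdiv : (a - lam) ^ 2 * (Real.cos t - τ * Real.sin t) ^ 2 / (a + c) / (a - lam) =
        (a - lam) * (Real.cos t - τ * Real.sin t) ^ 2 / (a + c) := by
      field_simp
    have hYdiv : (b - lam) ^ 2 * (Real.sin t + τ * Real.cos t) ^ 2 / (b + c) / (b - lam) =
        (b - lam) * (Real.sin t + τ * Real.cos t) ^ 2 / (b + c) := by
      field_simp
    have hZdiv (u v w : ℝ) : ((c + lam) ^ 2 * u +
        τ ^ 2 * ((c + lam) ^ 2 * v * (a - b) ^ 2 / w)) / (c + lam) =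
        (c + lam) * u + τ ^ 2 * ((c + lam) * v * (a - b) ^ 2 / w) := by
      rw [div_eq_iff hcl]
      ring
    have hnumer : a * Real.sin t ^ 2 + b * Real.cos t ^ 2 - lam =
        (a + c) * Real.sin t ^ 2 + (b + c) * Real.cos t ^ 2 - (c + lam) := by
      linear_combination -c * Real.sin_sq_add_cos_sq t
    rw [hX, hY, hZ, hz2, hXdiv, hYdiv, hZdiv, hnumer]
    linear_combination hpoint + 2 * τ * (Real.sin t * Real.cos t) * hcross + τ ^ 2 * hquad
  refine ⟨fun t => ?_, fun t => ?_, ?_, ?_, fun t => ?_⟩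
  · have hD := hDpos t
    refine ⟨?_, ?_, ?_⟩
    · rw [hden]
      linarith
    · rw [hnorm, hden, hnum]
      field_simp
    · rw [hnorm]
      positivity
  · rw [hzero]
    have := hnum t
    constructor <;> intro h <;> linarith
  · rintro ⟨t, ht⟩
    constructor <;> nlinarith [Real.neg_one_le_cos (2 * t), Real.cos_le_one (2 * t)]
  · rintro ⟨hl, hr⟩
    have hab' : 0 < a - b := sub_pos.2 hab
    have hk1 : -1 < (a + b - 2 * lam) / (a - b) := by
      rw [lt_div_iff₀ hab']
      linarith
    have hk2 : (a + b - 2 * lam) / (a - b) < 1 := by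
      rw [div_lt_one hab']
      linarith
    have hu0 : 0 < Real.arccos ((a + b - 2 * lam) / (a - b)) / 2 :=
      half_pos (Real.arccos_pos.2 hk2)
    have hu1 : Real.arccos ((a + b - 2 * lam) / (a - b)) / 2 < Real.pi / 2 := by
      have := Real.arccos_lt_pi.2 hk1
      linarith
    rw [← ncard_cos_two_mul_eq hu0 hu1]
    congr 1
    ext t
    rw [Set.mem_ofPred_eq, Set.mem_ofPred_eq, mul_div_cancel₀ _ two_ne_zero,
      Real.cos_arccos hk1.le hk2.le, eq_div_iff hab'.ne']
    refine and_congr_right fun _ => ?_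
    constructor <;> intro h <;> linarith
  · rw [hzero]
    simp only [hline]
    constructor
    · intro h
      have h := h 1
      rw [one_pow, one_mul, add_eq_left, div_eq_zero_iff, or_iff_left (hDpos t).ne'] at h
      exact h
    · intro h τ
      rw [h, zero_div, mul_zero, add_zero]
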